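/- Let B be a left semi-brace such that (G,+) is a finite nilpotent group and (E,∘) is a nilpotent group contained in the centralizer of G in (B,∘) (i.e. e∘g = g∘e for all e ∈ E and g ∈ G). Then B is left nilpotent if and only if the multiplicative group (B,∘) is nilpotent. -/

import Mathlib

/-- A left semi-brace: `(B,+)` is a left cancellative semigroup, `(B,*)` is a group
(whose identity `1` plays the role of `0` in the additive notation of the paper, and
`a⁻¹` plays the role of `a⁻`), and `a ∘ (b + c) = a ∘ b + a ∘ (a⁻ + c)` holds. -/
class LeftSemiBrace (B : Type*) extends Group B, Add B where
  add_assoc : ∀ a b c : B, a + b + c = a + (b + c)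
  add_left_cancel : ∀ a b c : B, a + b = a + c → b = c
  circ_add : ∀ a b c : B, a * (b + c) = a * b + a * (a⁻¹ + c)

namespace LeftSemiBrace

variable {B : Type*} [LeftSemiBrace B]

/-- The set `E` of additive idempotents. -/
def E (B : Type*) [LeftSemiBrace B] : Set B := {e | e + e = e}

/-- The set `G = B + 0`. -/
def G (B : Type*) [LeftSemiBrace B] : Set B := {x | ∃ b : B, x = b + 1}

/-- `λ_a (b) = a ∘ (a⁻ + b)`. -/
def lam (a b : B) : B := a * (a⁻¹ + b)

/-- `ρ_b (a) = (a⁻ + b)⁻ ∘ b`. -/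
def rho (b a : B) : B := (a⁻¹ + b)⁻¹ * b

/-- `a · b = λ_a(a⁻) + a ∘ b + λ_b(b⁻)`. -/
def dot (a b : B) : B := lam a a⁻¹ + a * b + lam b b⁻¹

/-- The group part `g_b = b + 0` of an element `b`. -/
def gp (b : B) : B := b + 1

/-- The additive inverse (within the group `(G,+)`) of the group part of an element:
for `g ∈ G` one has `neg g = -g`, since `-g_a = λ_a(a⁻) = a ∘ (a⁻ + a⁻)`. -/
def neg (a : B) : B := a * (a⁻¹ + a⁻¹)

/-- The idempotent part `e_b = -g_b + b` of an element `b`. -/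
def ep (b : B) : B := neg (gp b) + b

/-- `S` is a subsemigroup of `(B,+)`. -/
def IsAddSubsemigroup (S : Set B) : Prop := ∀ x ∈ S, ∀ y ∈ S, x + y ∈ S

/-- `S` is a subgroup of the multiplicative group `(B,∘)`. -/
def IsCircSubgroup (S : Set B) : Prop :=
  (1 : B) ∈ S ∧ (∀ x ∈ S, ∀ y ∈ S, x * y ∈ S) ∧ ∀ x ∈ S, x⁻¹ ∈ S

/-- `S` is a normal subgroup of the multiplicative group `(B,∘)`. -/
def IsCircNormal (S : Set B) : Prop :=
  IsCircSubgroup S ∧ ∀ x ∈ S, ∀ b : B, b * x * b⁻¹ ∈ S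

/-- `S` is a subgroup of the group `(G,+)`. -/
def IsAddSubgroupOfG (S : Set B) : Prop :=
  S ⊆ G B ∧ (1 : B) ∈ S ∧ (∀ x ∈ S, ∀ y ∈ S, x + y ∈ S) ∧ ∀ x ∈ S, neg x ∈ S

/-- `S` is a normal subgroup of the group `(G,+)`. -/
def IsAddNormalSubgroupOfG (S : Set B) : Prop :=
  IsAddSubgroupOfG S ∧ ∀ g ∈ G B, ∀ x ∈ S, g + x + neg g ∈ S

/-- `I` is an ideal of the left semi-brace `B` (Definition 17 of Catino–Colazzo–Stefanelli):
`I` is a subsemigroup of `(B,+)`, a normal subgroup of `(B,∘)`, `I ∩ G` is a normal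
subgroup of `(G,+)`, `ρ_b(n) ∈ I` for all `b ∈ B`, `n ∈ I ∩ G`, and `λ_g(e) ∈ I` for all
`g ∈ G`, `e ∈ I ∩ E`. -/
def IsIdeal (I : Set B) : Prop :=
  IsAddSubsemigroup I ∧ IsCircNormal I ∧ IsAddNormalSubgroupOfG (I ∩ G B) ∧
    (∀ b : B, ∀ n ∈ I ∩ G B, rho b n ∈ I) ∧
    (∀ g ∈ G B, ∀ e ∈ I ∩ E B, lam g e ∈ I)

/-- `I` is a left ideal of the left semi-brace `B`. -/
def IsLeftIdeal (I : Set B) : Prop :=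
  (∀ x ∈ I, x + 1 ∈ I) ∧ IsAddSubgroupOfG (I ∩ G B) ∧
    (∀ g ∈ G B, ∀ x ∈ I, lam g x ∈ I) ∧ IsCircSubgroup I

/-- The subgroup of `(G,+)` generated by a subset `S` of `G`. -/
def addClosure (S : Set B) : Set B :=
  ⋂₀ {T : Set B | S ⊆ T ∧ (1 : B) ∈ T ∧ (∀ x ∈ T, ∀ y ∈ T, x + y ∈ T) ∧ ∀ x ∈ T, neg x ∈ T}

/-- `X · Y`: the subgroup of `(G,+)` generated by `{x · y : x ∈ X, y ∈ Y}`. -/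
def dotSet (X Y : Set B) : Set B := addClosure {z | ∃ x ∈ X, ∃ y ∈ Y, z = dot x y}

/-- `S + E = {s + e : s ∈ S, e ∈ E}`. -/
def addE (S : Set B) : Set B := {z | ∃ s ∈ S, ∃ e ∈ E B, z = s + e}

/-- The right series of `B`: `rightSeries B n = B^(n+1)`, where `B^(1) = B` and
`B^(n+1) = B^(n) · B + E`. -/
def rightSeries (B : Type*) [LeftSemiBrace B] : ℕ → Set B
  | 0 => Set.univ
  | n + 1 => addE (dotSet (rightSeries B n) Set.univ)

/-- The left series of `B`: `leftSeries B n = B^(n+1)`, where `B^1 = B` and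
`B^(n+1) = B · B^n + E`. -/
def leftSeries (B : Type*) [LeftSemiBrace B] : ℕ → Set B
  | 0 => Set.univ
  | n + 1 => addE (dotSet Set.univ (leftSeries B n))

/-- The right series of the skew left brace `G`: `rightSeriesG B n = G^(n+1)`, where
`G^(1) = G` and `G^(n+1) = G^(n) · G`. -/
def rightSeriesG (B : Type*) [LeftSemiBrace B] : ℕ → Set B
  | 0 => G B
  | n + 1 => dotSet (rightSeriesG B n) (G B)

/-- The series `bracketSeries B n = B^[n+1]`, where `B^[1] = B` and `B^[n+1] = H_n + E`
with `H_n` the subgroup of `(G,+)` generated by `⋃_{i=1}^{n} B^[i] · B^[n+1-i]`. -/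
def bracketSeries (B : Type*) [LeftSemiBrace B] : ℕ → Set B
  | 0 => Set.univ
  | n + 1 =>
      addE (addClosure (⋃ i : Fin (n + 1),
        dotSet (bracketSeries B i.1) (bracketSeries B (n - i.1))))
  decreasing_by
  · exact i.isLt
  · exact Nat.lt_succ_of_le (Nat.sub_le n i.1)

/-- The socle `Soc(B) = {a ∈ B : ρ_a = ρ_0, λ_a = λ_0}`. -/
def Soc (B : Type*) [LeftSemiBrace B] : Set B :=
  {a | rho a = rho (1 : B) ∧ lam a = lam (1 : B)}

/-- The generalized socle `Zoc(B) = Soc(B) + E`. -/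
def Zoc (B : Type*) [LeftSemiBrace B] : Set B :=
  {z | ∃ a ∈ Soc B, ∃ e ∈ E B, z = a + e}

/-- The lower central series of the group `(G,+)`:  `γ_1 = G` and `γ_{n+1}` is the
subgroup of `(G,+)` generated by the additive commutators `-x - y + x + y` with
`x ∈ γ_n`, `y ∈ G`. -/
def lowerCentralSeriesG (B : Type*) [LeftSemiBrace B] : ℕ → Set B
  | 0 => G B
  | n + 1 => addClosure
      {z | ∃ x ∈ lowerCentralSeriesG B n, ∃ y ∈ G B, z = neg x + neg y + x + y}

/-- The group `(G,+)` is nilpotent. -/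
def IsNilpotentGAdd (B : Type*) [LeftSemiBrace B] : Prop :=
  ∃ n : ℕ, lowerCentralSeriesG B n = {(1 : B)}

/-! ### Generic group theory -/

/-- A finite group with pairwise commuting subgroups of full prime-power order is nilpotent. -/
theorem nilpotent_of_commuting_sylows {N : Type*} [Group N] [Finite N]
    (K : ℕ → Subgroup N)
    (hcard : ∀ p, p.Prime → Nat.card (K p) = p ^ (Nat.card N).factorization p)
    (hcomm : ∀ p q, p.Prime → q.Prime → p ≠ q → ∀ x ∈ K p, ∀ y ∈ K q, x * y = y * x) :
    Group.IsNilpotent N := by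
  have key : ∀ p, p.Prime → (K p).Normal := by
    intro p hp
    rw [← Subgroup.normalizer_eq_top_iff]
    have hdvd : Nat.card N ∣ Nat.card (Subgroup.normalizer (K p : Set N)) := by
      rw [← Nat.factorization_prime_le_iff_dvd Nat.card_pos.ne' Nat.card_pos.ne']
      intro q hq
      rw [← hq.pow_dvd_iff_le_factorization Nat.card_pos.ne', ← hcard q hq]
      apply Subgroup.card_dvd_of_le
      by_cases hpq : p = q
      · subst hpq; exact Subgroup.le_normalizer
      · intro y hy
        rw [Subgroup.mem_normalizer_iff]
        intro h
        constructor
        · intro hh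
          rw [← hcomm p q hp hq hpq h hh y hy]
          simpa using hh
        · intro hh
          have := hcomm p q hp hq hpq _ hh y hy
          have h2 : y * h * y⁻¹ = h := by
            have h3 : y * h = y * (y * h * y⁻¹) := by rw [← this]; group
            exact (mul_left_cancel h3).symm
          rwa [h2] at hh
    apply Subgroup.eq_top_of_card_eq
    exact Nat.dvd_antisymm (Subgroup.card_subgroup_dvd_card _) hdvd
  rw [Group.isNilpotent_of_finite_tfae.out 0 3 rfl rfl]
  intro p hp P
  have h1 : ((Sylow.ofCard (K p) (hcard p hp.out) : Sylow p N) : Subgroup N).Normal :=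
    key p hp.out
  have := Sylow.unique_of_normal _ h1
  have h2 : P = Sylow.ofCard (K p) (hcard p hp.out) := Subsingleton.elim _ _
  rw [h2]; exact h1

section cocycle

variable {A M : Type*} [Group A] [Group M] (φ : M →* MulAut A)

/-- The abstract left series. -/
def lser : ℕ → Subgroup A
  | 0 => ⊤
  | n + 1 => Subgroup.closure {z | ∃ m : M, ∃ x ∈ lser n, z = φ m x * x⁻¹}

open scoped commutatorElement in
theorem lser_le (n : ℕ) : lser φ n ≤
    ((⊤ : Subgroup (A ⋊[φ] M)).lowerCentralSeries n).comap SemidirectProduct.inl := by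
  induction n with
  | zero => intro x _; simp
  | succ n ih =>
    rw [lser, Subgroup.closure_le]
    rintro z ⟨m, x, hx, rfl⟩
    have hx' := ih hx
    change (SemidirectProduct.inl (φ m x * x⁻¹) : A ⋊[φ] M) ∈
      (⊤ : Subgroup (A ⋊[φ] M)).lowerCentralSeries (n + 1)
    rw [Subgroup.lowerCentralSeries_succ, Subgroup.commutator_comm]
    have : (SemidirectProduct.inl (φ m x * x⁻¹) : A ⋊[φ] M) =
        ⁅(SemidirectProduct.inr m : A ⋊[φ] M), (SemidirectProduct.inl x : A ⋊[φ] M)⁆ := by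
      rw [commutatorElement_def, map_mul, SemidirectProduct.inl_aut, map_inv, map_inv]
    rw [this]
    exact Subgroup.commutator_mem_commutator (Subgroup.mem_top _) hx'

/-- Preimage of an invariant subgroup under a bijective cocycle. -/
def cocSub (π : M ≃ A) (hπ : ∀ a b, π (a * b) = π a * φ a (π b)) (P : Subgroup A)
    (hP : ∀ m, ∀ x ∈ P, φ m x ∈ P) : Subgroup M where
  carrier := {m | π m ∈ P}
  one_mem' := by
    have h := hπ 1 1
    simp only [mul_one, map_one, MulAut.one_apply] at h
    have : π 1 = 1 := by simpa using h
    simp [this, P.one_mem]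
  mul_mem' := by
    intro a b ha hb
    simp only [Set.mem_ofPred_eq, hπ] at *
    exact P.mul_mem ha (hP _ _ hb)
  inv_mem' := by
    intro a ha
    simp only [Set.mem_ofPred_eq] at *
    have h1 : π 1 = 1 := by
      have h := hπ 1 1
      simp only [mul_one, map_one, MulAut.one_apply] at h
      simpa using h
    have h := hπ a⁻¹ a
    rw [inv_mul_cancel, h1] at h
    rw [eq_inv_of_mul_eq_one_left h.symm]
    exact P.inv_mem (hP _ _ ha)

theorem skew_main [Finite A] [Group.IsNilpotent A] (π : M ≃ A)
    (hπ : ∀ a b, π (a * b) = π a * φ a (π b)) :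
    (∃ n, lser φ n = ⊥) ↔ Group.IsNilpotent M := by
  classical
  have : Finite M := Finite.of_equiv A π.symm
  have hcardMA : Nat.card M = Nat.card A := Nat.card_congr π
  have hex : ∀ p : ℕ, ∃ P : Subgroup A, p.Prime →
      (P.Normal ∧ P.Characteristic ∧ IsPGroup p P ∧
        Nat.card P = p ^ (Nat.card A).factorization p) := by
    intro p
    by_cases hp : p.Prime
    · have : Fact p.Prime := ⟨hp⟩
      let P : Sylow p A := default
      have hn : (P : Subgroup A).Normal := inferInstance
      exact ⟨P, fun _ => ⟨hn, P.characteristic_of_normal hn, P.isPGroup', P.card_eq_multiplicity⟩⟩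
    · exact ⟨⊤, fun h => absurd h hp⟩
  choose P' hP' using hex
  let P : ℕ → Subgroup A := fun p => if p.Prime then P' p else ⊤
  have hP : ∀ p, p.Prime → ((P p).Normal ∧ (P p).Characteristic ∧ IsPGroup p (P p) ∧
        Nat.card (P p) = p ^ (Nat.card A).factorization p) := by
    intro p hp
    have hpp : P p = P' p := if_pos hp
    rw [hpp]
    exact hP' p hp
  have hinv : ∀ p, ∀ m, ∀ x ∈ P p, φ m x ∈ P p := by
    intro p m x hx
    by_cases hp : p.Prime
    · have := (hP p hp).2.1
      have h := Subgroup.characteristic_iff_comap_eq.mp this (φ m)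
      rw [← h] at hx
      exact hx
    · simp [P, hp]
  let H : ℕ → Subgroup M := fun p => cocSub φ π hπ (P p) (hinv p)
  have hH : ∀ p m, m ∈ H p ↔ π m ∈ P p := fun p m => Iff.rfl
  have hHP : ∀ p, Nat.card (H p) = Nat.card (P p) := by
    intro p
    exact Nat.card_congr (π.subtypeEquiv fun m => hH p m)
  have hHcard : ∀ p, p.Prime → Nat.card (H p) = p ^ (Nat.card M).factorization p := by
    intro p hp
    rw [hHP, hcardMA]; exact (hP p hp).2.2.2
  have hHp : ∀ p, p.Prime → IsPGroup p (H p) := fun p hp => IsPGroup.of_card (hHcard p hp)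
  have hdisj : ∀ p q, p.Prime → q.Prime → p ≠ q → Disjoint (P p) (P q) := by
    intro p q hp hq hpq
    have : Fact p.Prime := ⟨hp⟩
    have : Fact q.Prime := ⟨hq⟩
    exact IsPGroup.disjoint_of_ne p q hpq _ _ (hP p hp).2.2.1 (hP q hq).2.2.1
  have hPcomm : ∀ p q, p.Prime → q.Prime → p ≠ q → ∀ x ∈ P p, ∀ y ∈ P q, x * y = y * x := by
    intro p q hp hq hpq x hx y hy
    exact Subgroup.commute_of_normal_of_disjoint _ _ (hP p hp).1 (hP q hq).1
      (hdisj p q hp hq hpq) x y hx hy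
  constructor
  · rintro ⟨n, hn⟩
    have htriv : ∀ p q, p.Prime → q.Prime → p ≠ q → ∀ b ∈ H q, ∀ k ≤ n,
        ∀ x ∈ P p, x ∈ lser φ (n - k) → φ b x = x := by
      intro p q hp hq hpq b hb k
      induction k with
      | zero =>
        intro _ x _ hx
        rw [Nat.sub_zero, hn, Subgroup.mem_bot] at hx
        simp [hx]
      | succ k ih =>
        intro hk x hxP hx
        have hnk : n - k = (n - (k + 1)) + 1 := by omega
        have hy : φ b x * x⁻¹ ∈ lser φ (n - k) := by
          rw [hnk, lser]
          exact Subgroup.subset_closure ⟨b, x, hx, rfl⟩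
        have hyP : φ b x * x⁻¹ ∈ P p := (P p).mul_mem (hinv p b x hxP) ((P p).inv_mem hxP)
        have hfix := ih (by omega) _ hyP hy
        set y := φ b x * x⁻¹ with hydef
        have hbx : φ b x = y * x := by simp [hydef]
        clear_value y
        have hpow : ∀ j : ℕ, φ (b ^ j) x = y ^ j * x := by
          intro j
          induction j with
          | zero => simp
          | succ j ihj =>
            rw [pow_succ', map_mul, MulAut.mul_apply, ihj, map_mul, map_pow, hfix, hbx]
            rw [pow_succ, mul_assoc]
        obtain ⟨r, hr⟩ := hHp q hq ⟨b, hb⟩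
        have hr' : b ^ q ^ r = 1 := by simpa using congrArg Subtype.val hr
        have h1 := hpow (q ^ r)
        rw [hr', map_one, MulAut.one_apply] at h1
        have hyq : y ^ q ^ r = 1 := by simpa using h1.symm
        obtain ⟨s, hs⟩ := (hP p hp).2.2.1 ⟨y, hyP⟩
        have hyp : y ^ p ^ s = 1 := by simpa using congrArg Subtype.val hs
        have hy1 : y = 1 := by
          rw [← orderOf_eq_one_iff]
          apply Nat.eq_one_of_dvd_coprimes (a := p ^ s) (b := q ^ r)
          · exact Nat.Coprime.pow _ _ ((Nat.coprime_primes hp hq).2 hpq)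
          · exact orderOf_dvd_of_pow_eq_one hyp
          · exact orderOf_dvd_of_pow_eq_one hyq
        rw [hbx, hy1, one_mul]
    have htriv' : ∀ p q, p.Prime → q.Prime → p ≠ q → ∀ b ∈ H q, ∀ x ∈ P p, φ b x = x := by
      intro p q hp hq hpq b hb x hx
      refine htriv p q hp hq hpq b hb n le_rfl x hx ?_
      simp [lser]
    apply nilpotent_of_commuting_sylows H hHcard
    intro p q hp hq hpq a ha b hb
    apply π.injective
    rw [hπ, hπ, htriv' q p hq hp hpq.symm a ha _ hb, htriv' p q hp hq hpq b hb _ ha]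
    exact hPcomm p q hp hq hpq _ ha _ hb
  · intro hM
    have hHcomm : ∀ p q, p.Prime → q.Prime → p ≠ q → ∀ x ∈ H p, ∀ y ∈ H q, x * y = y * x := by
      intro p q hp hq hpq x hx y hy
      have : Fact p.Prime := ⟨hp⟩
      have : Fact q.Prime := ⟨hq⟩
      have n1 : (Sylow.ofCard (H p) (hHcard p hp) : Subgroup M).Normal := inferInstance
      have n2 : (Sylow.ofCard (H q) (hHcard q hq) : Subgroup M).Normal := inferInstance
      exact Subgroup.commute_of_normal_of_disjoint (H p) (H q) n1 n2
        (IsPGroup.disjoint_of_ne p q hpq _ _ (hHp p hp) (hHp q hq)) x y hx hy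
    have htriv : ∀ p q, p.Prime → q.Prime → p ≠ q → ∀ b ∈ H q, ∀ x ∈ P p, φ b x = x := by
      intro p q hp hq hpq b hb x hx
      obtain ⟨a, rfl⟩ := π.surjective x
      have h := congrArg π (hHcomm p q hp hq hpq a hx b hb)
      rw [hπ, hπ, hPcomm p q hp hq hpq _ hx _ (hinv q a _ hb)] at h
      have h2 : (π b)⁻¹ * φ a (π b) = φ b (π a) * (π a)⁻¹ := by
        rw [eq_mul_inv_iff_mul_eq, mul_assoc, h, inv_mul_cancel_left]
      have h3 : φ b (π a) * (π a)⁻¹ ∈ P p :=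
        (P p).mul_mem (hinv p b _ hx) ((P p).inv_mem hx)
      have h4 : φ b (π a) * (π a)⁻¹ ∈ P q := by
        rw [← h2]
        exact (P q).mul_mem ((P q).inv_mem hb) (hinv q a _ hb)
      have h5 := Subgroup.disjoint_def.mp (hdisj p q hp hq hpq) h3 h4
      exact mul_inv_eq_one.mp h5
    have : Finite (A ⋊[φ] M) := Finite.of_equiv _ SemidirectProduct.equivProd.symm
    let K : ℕ → Subgroup (A ⋊[φ] M) := fun p =>
      { carrier := {z | z.left ∈ P p ∧ z.right ∈ H p}
        one_mem' := ⟨(P p).one_mem, (H p).one_mem⟩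
        mul_mem' := by
          rintro a b ⟨ha, ha'⟩ ⟨hb, hb'⟩
          exact ⟨(P p).mul_mem ha (hinv p _ _ hb), (H p).mul_mem ha' hb'⟩
        inv_mem' := by
          rintro a ⟨ha, ha'⟩
          exact ⟨hinv p _ _ ((P p).inv_mem ha), (H p).inv_mem ha'⟩ }
    have hK : ∀ p z, z ∈ K p ↔ z.left ∈ P p ∧ z.right ∈ H p := fun p z => Iff.rfl
    have hN : Group.IsNilpotent (A ⋊[φ] M) := by
      apply nilpotent_of_commuting_sylows K
      · intro p hp
        have e : K p ≃ P p × H p :=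
          { toFun := fun z => (⟨z.1.left, z.2.1⟩, ⟨z.1.right, z.2.2⟩)
            invFun := fun z => ⟨⟨z.1.1, z.2.1⟩, ⟨z.1.2, z.2.2⟩⟩
            left_inv := fun z => rfl
            right_inv := fun z => rfl }
        rw [Nat.card_congr e, Nat.card_prod, SemidirectProduct.card,
          Nat.factorization_mul Nat.card_pos.ne' Nat.card_pos.ne', hHcard p hp,
          (hP p hp).2.2.2, Finsupp.add_apply, pow_add]
      · rintro p q hp hq hpq x ⟨hx, hx'⟩ y ⟨hy, hy'⟩
        apply SemidirectProduct.ext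
        · rw [SemidirectProduct.mul_left, SemidirectProduct.mul_left,
            htriv q p hq hp hpq.symm _ hx' _ hy, htriv p q hp hq hpq _ hy' _ hx]
          exact hPcomm p q hp hq hpq _ hx _ hy
        · exact hHcomm p q hp hq hpq _ hx' _ hy'
    obtain ⟨n, hn⟩ := Subgroup.nilpotent_iff_lowerCentralSeries.mp hN
    refine ⟨n, ?_⟩
    rw [eq_bot_iff]
    intro x hx
    have h := lser_le φ n hx
    rw [hn, Subgroup.mem_comap, Subgroup.mem_bot] at h
    rw [Subgroup.mem_bot]
    exact SemidirectProduct.inl_injective (by simpa using h)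

end cocycle

/-! ### Basic facts on semi-braces -/

theorem one_add' (c : B) : 1 + c = c := by
  have h := circ_add (1 : B) 1 c
  simp only [one_mul, inv_one] at h
  exact (add_left_cancel _ _ _ h).symm

theorem lam_add (a b c : B) : lam a (b + c) = lam a b + lam a c := by
  simp only [lam]
  rw [← add_assoc, circ_add]

theorem lam_mul (a b c : B) : lam (a * b) c = lam a (lam b c) := by
  simp only [lam]
  rw [mul_inv_rev, mul_assoc, circ_add b, mul_inv_cancel_left]

theorem lam_one (b : B) : lam 1 b = b := by simp [lam, one_add']

theorem mul_eq (a b : B) : a * b = a + lam a b := by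
  have h := circ_add a 1 b
  rwa [one_add', mul_one] at h

theorem mem_G {b : B} : b ∈ G B ↔ b + 1 = b := by
  constructor
  · rintro ⟨c, rfl⟩
    rw [add_assoc, one_add']
  · intro h; exact ⟨b, h.symm⟩

theorem idem_add {e : B} (he : e ∈ E B) (b : B) : e + b = b := by
  apply add_left_cancel e
  rw [← add_assoc, he]

theorem mem_E {b : B} : b ∈ E B ↔ b + 1 = 1 := by
  constructor
  · intro h; exact idem_add h 1
  · intro h
    change b + b = b
    have h2 : b + (1 + b) = b := by rw [← add_assoc, h, one_add']
    rwa [one_add'] at h2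

theorem lam_E (a : B) {e : B} (he : e ∈ E B) : lam a e ∈ E B := by
  change _ + _ = _
  rw [← lam_add, he]

theorem one_mem_E : (1 : B) ∈ E B := mem_E.2 (one_add' 1)

theorem mem_G_iff_lam {b : B} : b + 1 = b ↔ lam b 1 = 1 := by
  have h : b + lam b 1 = b := by rw [← mul_eq, mul_one]
  constructor
  · intro h1
    apply add_left_cancel b
    rw [h, h1]
  · intro h1
    rwa [h1] at h

theorem add_neg (a : B) : a + neg a = 1 := by
  have : neg a = lam a a⁻¹ := rfl
  rw [this, ← mul_eq, mul_inv_cancel]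

theorem neg_add_one (a : B) : neg a + 1 = neg a := by
  apply add_left_cancel a
  rw [← add_assoc, add_neg, one_add']

/-- `(G, +)` as a multiplicatively written group. -/
@[ext]
structure GA (B : Type*) [LeftSemiBrace B] where
  val : B
  prop : val + 1 = val

instance : Mul (GA B) := ⟨fun x y => ⟨x.1 + y.1, by rw [add_assoc, y.2]⟩⟩
instance : One (GA B) := ⟨⟨1, one_add' 1⟩⟩
instance : Inv (GA B) := ⟨fun x => ⟨neg x.1, neg_add_one _⟩⟩

theorem GA.mul_val (x y : GA B) : (x * y).1 = x.1 + y.1 := rfl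
theorem GA.one_val : (1 : GA B).1 = 1 := rfl
theorem GA.inv_val (x : GA B) : (x⁻¹).1 = neg x.1 := rfl

instance : Group (GA B) :=
  Group.ofLeftAxioms
    (fun x y z => GA.ext (add_assoc _ _ _))
    (fun x => GA.ext (one_add' _))
    (fun x => GA.ext (by
      apply add_left_cancel x.1
      rw [GA.mul_val, GA.inv_val, ← add_assoc, add_neg, one_add', GA.one_val, x.2]))

/-- `(G, ∘)` as a subgroup of `(B, ∘)`. -/
def GM (B : Type*) [LeftSemiBrace B] : Subgroup B where
  carrier := {b | b + 1 = b}
  one_mem' := one_add' 1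
  mul_mem' := by
    intro a b ha hb
    simp only [Set.mem_ofPred_eq, mem_G_iff_lam] at *
    rw [lam_mul, hb, ha]
  inv_mem' := by
    intro a ha
    simp only [Set.mem_ofPred_eq, mem_G_iff_lam] at *
    conv_lhs => rw [← ha]
    rw [← lam_mul, inv_mul_cancel, lam_one]

theorem GM_prop (g : GM B) : g.1 + 1 = g.1 := g.2

instance : MulDistribMulAction (GM B) (GA B) where
  smul g x := ⟨lam g.1 x.1, by
    conv_lhs => rw [← mem_G_iff_lam.1 (GM_prop g), ← lam_add, x.2]⟩
  one_smul x := GA.ext (lam_one _)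
  mul_smul g h x := GA.ext (lam_mul _ _ _)
  smul_mul g x y := GA.ext (lam_add _ _ _)
  smul_one g := GA.ext (mem_G_iff_lam.1 (GM_prop g))

/-- The action of `(G,∘)` on `(G,+)`. -/
def phi (B : Type*) [LeftSemiBrace B] : GM B →* MulAut (GA B) :=
  MulDistribMulAction.toMulAut (GM B) (GA B)

theorem phi_val (g : GM B) (x : GA B) : (phi B g x).1 = lam g.1 x.1 := rfl

/-- The identity map between the two group structures. -/
def piEquiv (B : Type*) [LeftSemiBrace B] : GM B ≃ GA B where
  toFun g := ⟨g.1, g.2⟩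
  invFun x := ⟨x.1, x.2⟩
  left_inv _ := rfl
  right_inv _ := rfl

/-- Subgroup of `GA` from an additive closure. -/
def closSub (S : Set B) : Subgroup (GA B) where
  carrier := {x | x.1 ∈ addClosure S}
  one_mem' := fun _ hT => hT.2.1
  mul_mem' := fun {_ _} ha hb T hT => hT.2.2.1 _ (ha T hT) _ (hb T hT)
  inv_mem' := fun {_} ha T hT => hT.2.2.2 _ (ha T hT)

theorem subset_addClosure (S : Set B) : S ⊆ addClosure S := fun _ hx _ hT => hT.1 hx

theorem lcs_sub (n : ℕ) : ∀ a ∈ (⊤ : Subgroup (GA B)).lowerCentralSeries n,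
    a.1 ∈ lowerCentralSeriesG B n := by
  induction n with
  | zero => intro a _; exact mem_G.2 a.2
  | succ n ih =>
    rw [Subgroup.lowerCentralSeries_succ, lowerCentralSeriesG]
    change _ ≤ closSub _
    rw [Subgroup.commutator_le]
    intro x hx y _
    apply subset_addClosure
    refine ⟨(x⁻¹).1, ih _ (Subgroup.inv_mem _ hx), (y⁻¹).1, mem_G.2 (y⁻¹).2, ?_⟩
    rw [← GA.inv_val, ← GA.inv_val, inv_inv, inv_inv, commutatorElement_def]
    rfl

theorem GA_nilpotent (h : IsNilpotentGAdd B) : Group.IsNilpotent (GA B) := by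
  obtain ⟨n, hn⟩ := h
  rw [Subgroup.nilpotent_iff_lowerCentralSeries]
  refine ⟨n, ?_⟩
  rw [eq_bot_iff]
  intro x hx
  have := lcs_sub n x hx
  rw [hn] at this
  exact Subgroup.mem_bot.2 (GA.ext this)

/-- The group part as an element of `GA`. -/
def toGA (b : B) : GA B := ⟨b + 1, by rw [add_assoc, one_add']⟩

/-- The group part as an element of `GM`. -/
def toGM (b : B) : GM B := ⟨b + 1, (toGA b).2⟩

theorem toGA_self (x : GA B) : toGA x.1 = x := GA.ext x.2

theorem toGA_add_E (x : GA B) {e : B} (he : e ∈ E B) : toGA (x.1 + e) = x :=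
  GA.ext (by change _ + _ + _ = _; rw [add_assoc, mem_E.1 he, x.2])

theorem decomp (b : B) : ∃ e ∈ E B, b = (b + 1) + e := by
  refine ⟨neg (b + 1) + b, ?_, ?_⟩
  · rw [mem_E, add_assoc]
    have := congrArg GA.val (inv_mul_cancel (toGA b))
    exact this
  · rw [← add_assoc, add_neg, one_add']

theorem decomp_mul (b : B) : ∃ e ∈ E B, b = (b + 1) * e := by
  obtain ⟨e, he, hb⟩ := decomp b
  refine ⟨lam (b + 1)⁻¹ e, lam_E _ he, ?_⟩
  rw [mul_eq, ← lam_mul, mul_inv_cancel, lam_one]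
  exact hb

theorem neg_eq (b : B) : neg b = neg (b + 1) := by
  apply add_left_cancel (b + 1)
  rw [add_neg, add_assoc, one_add', add_neg]

theorem dot_eq (hcent : ∀ e ∈ E B, ∀ g ∈ G B, e * g = g * e) (a b : B) :
    dot a b = (phi B (toGM a) (toGA b) * (toGA b)⁻¹).1 := by
  rw [GA.mul_val, GA.inv_val, phi_val]
  change neg a + a * b + neg b = lam (a + 1) (b + 1) + neg (b + 1)
  rw [← neg_eq]
  have h1 : neg a + (a * b) = lam a b := by
    rw [mul_eq, ← add_assoc]
    apply idem_add
    rw [mem_E, add_assoc, neg_eq]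
    exact congrArg GA.val (inv_mul_cancel (toGA a))
  rw [h1]
  obtain ⟨f, hf, hb⟩ := decomp b
  obtain ⟨e, he, ha⟩ := decomp_mul a
  have h2 : lam a b + neg b = lam a (b + 1) + neg b := by
    have h5 : lam a b = lam a (b + 1) + lam a f := by rw [← lam_add, ← hb]
    rw [h5, add_assoc, idem_add (lam_E a hf)]
  rw [h2]
  have h3 : lam a (b + 1) = lam (a + 1) (lam e (b + 1)) := by
    rw [← lam_mul, ← ha]
  have h4 : lam e (b + 1) = (b + 1) + lam (b + 1) e := by
    rw [← mul_eq, ← hcent e he _ ⟨b, rfl⟩, mul_eq, idem_add he]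
  rw [h3, h4, lam_add, add_assoc, idem_add (lam_E _ (lam_E _ he))]

theorem leftSeries_eq (hcent : ∀ e ∈ E B, ∀ g ∈ G B, e * g = g * e) (n : ℕ) :
    ∀ b : B, b ∈ leftSeries B n ↔ toGA b ∈ lser (phi B) n := by
  induction n with
  | zero => intro b; simp [leftSeries, lser]
  | succ n ih =>
    have key : ∀ z : B, z ∈ dotSet Set.univ (leftSeries B n) ↔
        ∃ x ∈ lser (phi B) (n + 1), z = x.1 := by
      intro z
      constructor
      · intro hz
        refine hz {z | ∃ x ∈ lser (phi B) (n + 1), z = x.1} ⟨?_, ?_, ?_, ?_⟩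
        · rintro z ⟨a, -, b, hb, rfl⟩
          refine ⟨_, ?_, dot_eq hcent a b⟩
          rw [lser]
          exact Subgroup.subset_closure ⟨_, _, (ih b).1 hb, rfl⟩
        · exact ⟨1, Subgroup.one_mem _, rfl⟩
        · rintro _ ⟨x, hx, rfl⟩ _ ⟨y, hy, rfl⟩
          exact ⟨x * y, Subgroup.mul_mem _ hx hy, rfl⟩
        · rintro _ ⟨x, hx, rfl⟩
          exact ⟨x⁻¹, Subgroup.inv_mem _ hx, rfl⟩
      · rintro ⟨x, hx, rfl⟩
        have hle : lser (phi B) (n + 1) ≤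
            closSub {z | ∃ x ∈ Set.univ, ∃ y ∈ leftSeries B n, z = dot x y} := by
          rw [lser, Subgroup.closure_le]
          rintro _ ⟨m, x, hx, rfl⟩
          apply subset_addClosure
          refine ⟨m.1, Set.mem_univ _, x.1, (ih _).2 (by rwa [toGA_self]), ?_⟩
          rw [dot_eq hcent, toGA_self]
          have : toGM m.1 = m := Subtype.ext (GM_prop m)
          rw [this]
        exact hle hx
    intro b
    rw [leftSeries]
    constructor
    · rintro ⟨s, hs, e, he, rfl⟩
      obtain ⟨x, hx, rfl⟩ := (key s).1 hs
      rwa [toGA_add_E x he]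
    · intro h
      obtain ⟨e, he, hb⟩ := decomp b
      exact ⟨b + 1, (key _).2 ⟨_, h, rfl⟩, e, he, hb⟩

theorem leftSeries_eq_E_iff (hcent : ∀ e ∈ E B, ∀ g ∈ G B, e * g = g * e) (n : ℕ) :
    leftSeries B n = E B ↔ lser (phi B) n = ⊥ := by
  constructor
  · intro h
    rw [eq_bot_iff]
    intro x hx
    have h1 : x.1 ∈ leftSeries B n := (leftSeries_eq hcent n _).2 (by rwa [toGA_self])
    rw [h, mem_E, x.2] at h1
    exact Subgroup.mem_bot.2 (GA.ext h1)
  · intro h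
    ext b
    rw [leftSeries_eq hcent, h, Subgroup.mem_bot, mem_E]
    exact ⟨fun h => congrArg GA.val h, fun h => GA.ext h⟩

theorem nilpotent_iff_GM
    (hEnil : ∃ H : Subgroup B, (H : Set B) = E B ∧ Group.IsNilpotent H)
    (hcent : ∀ e ∈ E B, ∀ g ∈ G B, e * g = g * e) :
    Group.IsNilpotent (GM B) ↔ Group.IsNilpotent B := by
  constructor
  · intro hG
    obtain ⟨H, hH, hHn⟩ := hEnil
    have hmem : ∀ x, x ∈ H ↔ x ∈ E B := fun x => by rw [← hH]; rfl
    let f : GM B × H →* B := MonoidHom.noncommCoprod (GM B).subtype H.subtype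
      (fun g e => (hcent e.1 ((hmem _).1 e.2) g.1 (mem_G.2 (GM_prop g))).symm)
    refine Group.nilpotent_of_surjective f ?_
    intro b
    obtain ⟨e, he, hb⟩ := decomp_mul b
    refine ⟨(toGM b, ⟨e, (hmem e).2 he⟩), ?_⟩
    exact hb.symm
  · intro h
    infer_instance

/-- let `B` be a left semi-brace such that `(G,+)` is a finite
nilpotent group and `(E,∘)` is a nilpotent group contained in the centralizer of `G`
in `(B,∘)`. Then `B` is left nilpotent iff the multiplicative group `(B,∘)` is
nilpotent (here `leftSeries B n = B^(n+1)`). -/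
theorem leftNilpotent_iff_isNilpotent (B : Type*) [LeftSemiBrace B]
    (hGfin : (G B).Finite) (hGnil : IsNilpotentGAdd B)
    (hEnil : ∃ H : Subgroup B, (H : Set B) = E B ∧ Group.IsNilpotent H)
    (hcent : ∀ e ∈ E B, ∀ g ∈ G B, e * g = g * e) :
    (∃ n : ℕ, leftSeries B n = E B) ↔ Group.IsNilpotent B := by
  have hfin : Finite (GA B) := by
    have : Finite (G B) := hGfin
    exact Finite.of_injective (fun x : GA B => (⟨x.1, mem_G.2 x.2⟩ : G B))
      (fun x y h => GA.ext (congrArg Subtype.val h))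
  have hn : Group.IsNilpotent (GA B) := GA_nilpotent hGnil
  rw [← nilpotent_iff_GM hEnil hcent,
    ← skew_main (phi B) (piEquiv B) (fun a b => GA.ext (mul_eq a.1 b.1))]
  exact exists_congr fun n => leftSeries_eq_E_iff hcent n

end LeftSemiBrace
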